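/- In the bounded-degree uniform attachment process, for every k with m ≤ k ≤ d, X_k(n) → ρ_k almost surely as n → ∞, with convergence rate |X_k(n) − ρ_k| = o(n^{−1/2+δ}) almost surely for every δ > 0. -/

import Mathlib

open MeasureTheory ProbabilityTheory Filter Topology
open scoped ENNReal

/-- The degree of a vertex in a simple graph on `ℕ` (the number of its neighbours). -/
noncomputable def graphDeg (g : SimpleGraph ℕ) (v : ℕ) : ℕ := (g.neighborSet v).ncard

/-- The complete graph on the vertex set `[m] = {1,…,m}`, viewed as a simple graph on `ℕ`. -/
def initGraph (m : ℕ) : SimpleGraph ℕ :=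
  SimpleGraph.fromRel (fun a b => a ∈ Finset.Icc 1 m ∧ b ∈ Finset.Icc 1 m)

/-- The graph obtained from `g` by joining the (new) vertex `v` to every vertex of `S`. -/
def attachStep (g : SimpleGraph ℕ) (v : ℕ) (S : Finset ℕ) : SimpleGraph ℕ :=
  g ⊔ SimpleGraph.fromRel (fun a b => a = v ∧ b ∈ S)

/-- The set of vertices of `[n] = {1,…,n}` whose degree in `g` is strictly less than `d`. -/
noncomputable def lowDegSet (d : ℕ) (g : SimpleGraph ℕ) (n : ℕ) : Finset ℕ :=
  (Finset.Icc 1 n).filter (fun v => graphDeg g v < d)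

/-- `IsUAProcess m d μ G` says that `(G n)_{n ≥ m}` (as random graphs on `ℕ`, with `G n`
supported on the vertex set `[n] = {1,…,n}`) is the bounded-degree uniform attachment
process: `G m` is the complete graph on `[m]`, and `G (n+1)` is obtained from `G n` by
joining the new vertex `n+1` to a uniformly chosen `m`-element subset of the set of
vertices of `G n` of degree less than `d`, conditionally on `G n` and independently of
the past (note that `G n` determines the whole past of the process). -/
def IsUAProcess (m d : ℕ) {Ω : Type*} [MeasurableSpace Ω] (μ : Measure Ω)
    (G : ℕ → Ω → SimpleGraph ℕ) : Prop :=
  (∀ n g, MeasurableSet {ω | G n ω = g}) ∧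
  (∀ ω, G m ω = initGraph m) ∧
  (∀ n, m ≤ n → ∀ g : SimpleGraph ℕ, ∀ S : Finset ℕ,
    S ⊆ lowDegSet d g n → S.card = m →
    μ ({ω | G (n + 1) ω = attachStep g (n + 1) S} ∩ {ω | G n ω = g})
      = μ {ω | G n ω = g} / (((lowDegSet d g n).card.choose m : ℝ≥0∞)))

/-- `degCount g n k` is the number of vertices of `[n] = {1,…,n}` of degree `k` in `g`
(this is `N_k(n)` when `g = G_n`). -/
noncomputable def degCount (g : SimpleGraph ℕ) (n k : ℕ) : ℕ :=
  ((Finset.Icc 1 n).filter (fun v => graphDeg g v = k)).card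

/-! ### Combinatorics of one attachment step -/

/-- The number of vertices of `[n]` of degree at least `k`. -/
noncomputable def tailCount (g : SimpleGraph ℕ) (n k : ℕ) : ℕ :=
  ((Finset.Icc 1 n).filter (fun v => k ≤ graphDeg g v)).card

/-- The graph `g` with all edges leaving `{0,…,j}` removed. -/
def graphRestrict (j : ℕ) (g : SimpleGraph ℕ) : SimpleGraph ℕ where
  Adj a b := g.Adj a b ∧ a ≤ j ∧ b ≤ j
  symm := ⟨fun _ _ h => ⟨h.1.symm, h.2.2, h.2.1⟩⟩
  loopless := ⟨fun _ h => h.1.ne rfl⟩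

/-- The invariants of the graphs that occur at time `n` of the process. -/
structure IsAdmissible (m d n : ℕ) (g : SimpleGraph ℕ) : Prop where
  mem_of_adj : ∀ a b, g.Adj a b → a ∈ Finset.Icc 1 n
  deg_le : ∀ v ∈ Finset.Icc 1 n, graphDeg g v ≤ d
  deg_add_le : ∀ v ∈ Finset.Icc 1 n, graphDeg g v + v ≤ m + n

lemma attachStep_adj {g : SimpleGraph ℕ} {v : ℕ} {S : Finset ℕ} {a b : ℕ} :
    (attachStep g v S).Adj a b ↔ g.Adj a b ∨ a ≠ b ∧ (a = v ∧ b ∈ S ∨ b = v ∧ a ∈ S) := by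
  simp [attachStep]

namespace IsAdmissible

variable {m d n : ℕ} {g : SimpleGraph ℕ}

lemma finite_neighborSet (hg : IsAdmissible m d n g) (v : ℕ) : (g.neighborSet v).Finite :=
  (Finset.finite_toSet (Finset.Icc 1 n)).subset fun b hb => hg.mem_of_adj b v (SimpleGraph.Adj.symm hb)

lemma not_adj_succ (hg : IsAdmissible m d n g) (v : ℕ) : ¬ g.Adj (n + 1) v := fun h => by
  have := hg.mem_of_adj _ _ h
  simp at this

lemma graphDeg_attachStep (hg : IsAdmissible m d n g) {S : Finset ℕ}
    {v : ℕ} (hv : v ∈ Finset.Icc 1 n) :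
    graphDeg (attachStep g (n + 1) S) v = graphDeg g v + if v ∈ S then 1 else 0 := by
  have hvn : v ≠ n + 1 := by simp at hv; omega
  unfold graphDeg
  split_ifs with h
  · have : (attachStep g (n + 1) S).neighborSet v = insert (n + 1) (g.neighborSet v) := by
      ext b
      simp only [SimpleGraph.mem_neighborSet, attachStep_adj, Set.mem_insert_iff]
      grind
    rw [this, Set.ncard_insert_of_notMem _ (hg.finite_neighborSet v)]
    exact fun hb => hg.not_adj_succ v (SimpleGraph.Adj.symm hb)
  · have : (attachStep g (n + 1) S).neighborSet v = g.neighborSet v := by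
      ext b
      simp only [SimpleGraph.mem_neighborSet, attachStep_adj]
      grind
    rw [this, add_zero]

lemma neighborSet_attachStep_succ (hg : IsAdmissible m d n g) {S : Finset ℕ}
    (hS : S ⊆ Finset.Icc 1 n) :
    (attachStep g (n + 1) S).neighborSet (n + 1) = S := by
  ext b
  have h1 := hg.not_adj_succ b
  have h2 : b ∈ S → b ≠ n + 1 := fun hb => by
    have := hS hb
    simp at this
    omega
  simp only [SimpleGraph.mem_neighborSet, attachStep_adj, Finset.mem_coe]
  grind

lemma graphDeg_attachStep_succ (hg : IsAdmissible m d n g) {S : Finset ℕ}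
    (hS : S ⊆ Finset.Icc 1 n) :
    graphDeg (attachStep g (n + 1) S) (n + 1) = S.card := by
  rw [graphDeg, hg.neighborSet_attachStep_succ hS, Set.ncard_coe_finset]

lemma graphRestrict_eq (hg : IsAdmissible m d n g) : graphRestrict n g = g := by
  ext a b
  simp only [graphRestrict, and_iff_left_iff_imp]
  intro h
  have h1 := hg.mem_of_adj _ _ h
  have h2 := hg.mem_of_adj _ _ h.symm
  simp at h1 h2
  omega

end IsAdmissible

lemma graphRestrict_attachStep {g : SimpleGraph ℕ} {j n : ℕ} (h : j ≤ n) (S : Finset ℕ) :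
    graphRestrict j (attachStep g (n + 1) S) = graphRestrict j g := by
  ext a b
  simp only [graphRestrict, attachStep_adj]
  grind

lemma lowDegSet_subset (d : ℕ) (g : SimpleGraph ℕ) (n : ℕ) :
    lowDegSet d g n ⊆ Finset.Icc 1 n := Finset.filter_subset _ _

lemma attachStep_inj {m d n : ℕ} {g g' : SimpleGraph ℕ} (hg : IsAdmissible m d n g)
    (hg' : IsAdmissible m d n g') {S S' : Finset ℕ} (hS : S ⊆ Finset.Icc 1 n)
    (hS' : S' ⊆ Finset.Icc 1 n) (h : attachStep g (n + 1) S = attachStep g' (n + 1) S') :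
    g = g' ∧ S = S' := by
  refine ⟨?_, ?_⟩
  · rw [← hg.graphRestrict_eq, ← hg'.graphRestrict_eq, ← graphRestrict_attachStep le_rfl S, h,
      graphRestrict_attachStep le_rfl]
  · rw [← Finset.coe_inj, ← hg.neighborSet_attachStep_succ hS,
      ← hg'.neighborSet_attachStep_succ hS', h]

lemma IsAdmissible.initGraph (m d : ℕ) (hd : m ≤ d) : IsAdmissible m d m (initGraph m) := by
  have hsub : ∀ a b, (_root_.initGraph m).Adj a b → a ∈ Finset.Icc 1 m := by
    intro a b h
    simp [_root_.initGraph] at h ⊢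
    omega
  have hdeg : ∀ v, graphDeg (_root_.initGraph m) v ≤ m := by
    intro v
    have : (_root_.initGraph m).neighborSet v ⊆ (Finset.Icc 1 m : Finset ℕ) :=
      fun b hb => hsub b v (SimpleGraph.Adj.symm hb)
    have h := Set.ncard_le_ncard this (Finset.finite_toSet _)
    rwa [Set.ncard_coe_finset, Nat.card_Icc, Nat.add_sub_cancel] at h
  refine ⟨hsub, fun v _ => (hdeg v).trans hd, fun v hv => ?_⟩
  have := hdeg v
  simp at hv
  omega

lemma IsAdmissible.attachStep {m d n : ℕ} {g : SimpleGraph ℕ} (hd : m ≤ d)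
    (hg : IsAdmissible m d n g) {S : Finset ℕ} (hS : S ⊆ lowDegSet d g n) (hSm : S.card = m) :
    IsAdmissible m d (n + 1) (attachStep g (n + 1) S) := by
  have hS' := hS.trans (lowDegSet_subset d g n)
  have hcases : ∀ v ∈ Finset.Icc 1 (n + 1), v ∈ Finset.Icc 1 n ∨ v = n + 1 := by
    intro v hv
    simp at hv ⊢
    omega
  have hnew := hg.graphDeg_attachStep_succ hS'
  refine ⟨fun a b h => ?_, fun v hv => ?_, fun v hv => ?_⟩
  · rw [attachStep_adj] at h
    rcases h with h | ⟨-, ⟨rfl, -⟩ | ⟨-, h⟩⟩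
    · exact Finset.Icc_subset_Icc_right (Nat.le_succ n) (hg.mem_of_adj a b h)
    · simp
    · exact Finset.Icc_subset_Icc_right (Nat.le_succ n) (hS' h)
  · rcases hcases v hv with h | rfl
    · rw [hg.graphDeg_attachStep h]
      have h1 := hg.deg_le v h
      split_ifs with hvS
      · have := (Finset.mem_filter.1 (hS hvS)).2
        omega
      · omega
    · omega
  · rcases hcases v hv with h | rfl
    · rw [hg.graphDeg_attachStep h]
      have h1 := hg.deg_add_le v h
      split_ifs <;> omega
    · omega

lemma IsAdmissible.le_card_lowDegSet {m d n : ℕ} {g : SimpleGraph ℕ} (hd : 2 * m < d)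
    (hn : m ≤ n) (hg : IsAdmissible m d n g) : m ≤ (lowDegSet d g n).card := by
  have hsub : Finset.Ioc (n - m) n ⊆ lowDegSet d g n := by
    intro v hv
    simp only [Finset.mem_Ioc] at hv
    have hv' : v ∈ Finset.Icc 1 n := by simp; omega
    refine Finset.mem_filter.2 ⟨hv', ?_⟩
    have := hg.deg_add_le v hv'
    omega
  have := Finset.card_le_card hsub
  rw [Nat.card_Ioc] at this
  omega

lemma tailCount_attachStep {m d n : ℕ} {g : SimpleGraph ℕ} (hg : IsAdmissible m d n g)
    {S : Finset ℕ} (hS : S ⊆ Finset.Icc 1 n) (k : ℕ) :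
    tailCount (attachStep g (n + 1) S) (n + 1) k
      = tailCount g n k + (if k ≤ S.card then 1 else 0)
        + (S.filter (fun v => graphDeg g v + 1 = k)).card := by
  have hS'' : S.filter (fun v => graphDeg g v + 1 = k)
      = (Finset.Icc 1 n).filter (fun v => v ∈ S ∧ graphDeg g v + 1 = k) := by
    ext v
    simp only [Finset.mem_filter]
    exact ⟨fun h => ⟨hS h.1, h⟩, fun h => h.2⟩
  have hI : Finset.Icc 1 (n + 1) = insert (n + 1) (Finset.Icc 1 n) := by
    ext v
    simp only [Finset.mem_Icc, Finset.mem_insert]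
    omega
  rw [hS'', tailCount, tailCount, Finset.card_filter, Finset.card_filter, Finset.card_filter, hI,
    Finset.sum_insert (by simp), hg.graphDeg_attachStep_succ hS, add_right_comm,
    ← Finset.sum_add_distrib, add_comm]
  congr 1
  refine Finset.sum_congr rfl fun v hv => ?_
  rw [hg.graphDeg_attachStep hv]
  grind

lemma card_lowDegSet_filter {d k : ℕ} (hk : k < d) (g : SimpleGraph ℕ) (n : ℕ) :
    tailCount g n k
      = tailCount g n (k + 1) + ((lowDegSet d g n).filter (fun v => graphDeg g v + 1 = k + 1)).card
    := by
  rw [tailCount, tailCount, lowDegSet, Finset.filter_filter, Finset.card_filter,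
    Finset.card_filter, Finset.card_filter, ← Finset.sum_add_distrib]
  refine Finset.sum_congr rfl fun v _ => ?_
  grind

lemma card_lowDegSet_add_tailCount (d : ℕ) (g : SimpleGraph ℕ) (n : ℕ) :
    (lowDegSet d g n).card + tailCount g n d = n := by
  rw [tailCount, lowDegSet, Finset.card_filter, Finset.card_filter, ← Finset.sum_add_distrib]
  rw [Finset.sum_congr rfl (g := fun _ => 1) fun v _ => by grind]
  simp

lemma tailCount_zero (g : SimpleGraph ℕ) (n : ℕ) : tailCount g n 0 = n := by
  simp [tailCount]

lemma degCount_add_tailCount (g : SimpleGraph ℕ) (n k : ℕ) :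
    degCount g n k + tailCount g n (k + 1) = tailCount g n k := by
  rw [tailCount, tailCount, degCount, Finset.card_filter, Finset.card_filter, Finset.card_filter,
    ← Finset.sum_add_distrib]
  exact Finset.sum_congr rfl fun v _ => by grind

lemma IsAdmissible.degCount_eq_tailCount {m d n : ℕ} {g : SimpleGraph ℕ}
    (hg : IsAdmissible m d n g) : degCount g n d = tailCount g n d := by
  rw [degCount, tailCount]
  congr 1
  refine Finset.filter_congr fun v hv => ?_
  have := hg.deg_le v hv
  omega

/-! ### Averages over subsets of fixed size -/

lemma card_powersetCard_filter_mem {α : Type*} [DecidableEq α] {A : Finset α} {v : α}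
    (hv : v ∈ A) (j : ℕ) :
    ((A.powersetCard (j + 1)).filter (fun S => v ∈ S)).card = (A.card - 1).choose j := by
  rw [← Finset.card_erase_of_mem hv, ← Finset.card_powersetCard]
  symm
  refine Finset.card_bij' (fun S _ => insert v S) (fun S _ => S.erase v) ?_ ?_ ?_ ?_
  · intro S hS
    rw [Finset.mem_powersetCard] at hS
    have hvS : v ∉ S := fun h => by simpa using hS.1 h
    rw [Finset.mem_filter, Finset.mem_powersetCard, Finset.card_insert_of_notMem hvS, hS.2]
    exact ⟨⟨Finset.insert_subset hv (hS.1.trans (Finset.erase_subset _ _)), rfl⟩,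
      Finset.mem_insert_self _ _⟩
  · intro S hS
    rw [Finset.mem_filter, Finset.mem_powersetCard] at hS
    rw [Finset.mem_powersetCard, Finset.card_erase_of_mem hS.2, hS.1.2]
    exact ⟨Finset.erase_subset_erase _ hS.1.1, rfl⟩
  · intro S hS
    rw [Finset.mem_powersetCard] at hS
    exact Finset.erase_insert fun h => by simpa using hS.1 h
  · intro S hS
    exact Finset.insert_erase (Finset.mem_filter.1 hS).2

lemma sum_powersetCard_card_filter {α : Type*} [DecidableEq α] (A : Finset α) (p : α → Prop)
    [DecidablePred p] {m : ℕ} (hm : 1 ≤ m) (hA : m ≤ A.card) :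
    ∑ S ∈ A.powersetCard m,
      (((S.filter p).card : ℝ) - m * (A.filter p).card / A.card) = 0 := by
  obtain ⟨j, rfl⟩ : ∃ j, m = j + 1 := ⟨m - 1, by omega⟩
  have hdouble : ∑ S ∈ A.powersetCard (j + 1), (S.filter p).card
      = (A.filter p).card * (A.card - 1).choose j := by
    have h1 : ∀ S ∈ A.powersetCard (j + 1), (S.filter p).card
        = ∑ v ∈ A.filter p, if v ∈ S then 1 else 0 := by
      intro S hS
      rw [← Finset.card_filter]
      congr 1
      ext v
      simp only [Finset.mem_filter]
      have := @(Finset.mem_powersetCard.1 hS).1 v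
      tauto
    rw [Finset.sum_congr rfl h1, Finset.sum_comm, Finset.card_eq_sum_ones, Finset.sum_mul]
    refine Finset.sum_congr rfl fun v hv => ?_
    rw [← Finset.card_filter, card_powersetCard_filter_mem (Finset.mem_filter.1 hv).1, one_mul]
  obtain ⟨L, hL⟩ : ∃ L, A.card = L + 1 := ⟨A.card - 1, by omega⟩
  have hchoose : ((L : ℝ) + 1) * L.choose j = (L + 1).choose (j + 1) * (j + 1) := by
    exact_mod_cast Nat.add_one_mul_choose_eq L j
  rw [Finset.sum_sub_distrib, Finset.sum_const, Finset.card_powersetCard, nsmul_eq_mul,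
    ← Nat.cast_sum, hdouble, hL, Nat.add_sub_cancel]
  push_cast
  have : (L : ℝ) + 1 ≠ 0 := by positivity
  field_simp
  linear_combination (((A.filter p).card : ℝ)) * hchoose

lemma sum_exp_le_of_sum_eq_zero {ι : Type*} (s : Finset ι) (f : ι → ℝ) {t b : ℝ}
    (hf : ∑ i ∈ s, f i = 0) (hb : ∀ i ∈ s, |f i| ≤ b) (htb : |t| * b ≤ 1) :
    ∑ i ∈ s, Real.exp (t * f i) ≤ s.card * Real.exp (t ^ 2 * b ^ 2) := by
  have key : ∀ i ∈ s, Real.exp (t * f i) ≤ Real.exp (t ^ 2 * b ^ 2) + t * f i := by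
    intro i hi
    have hle : |t * f i| ≤ 1 := by
      rw [abs_mul]
      exact (mul_le_mul_of_nonneg_left (hb i hi) (abs_nonneg t)).trans htb
    have h1 := (abs_le.1 (Real.abs_exp_sub_one_sub_id_le hle)).2
    have h2 := Real.add_one_le_exp (t ^ 2 * b ^ 2)
    have h3 : f i ^ 2 ≤ b ^ 2 := sq_le_sq' (abs_le.1 (hb i hi)).1 (abs_le.1 (hb i hi)).2
    nlinarith [mul_le_mul_of_nonneg_left h3 (sq_nonneg t)]
  calc _ ≤ ∑ i ∈ s, (Real.exp (t ^ 2 * b ^ 2) + t * f i) := Finset.sum_le_sum key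
    _ = _ := by rw [Finset.sum_add_distrib, ← Finset.mul_sum, hf]; simp

/-! ### The martingale part of the tail counts -/

open scoped Classical in
/-- The finite set of graphs that the process can reach at time `m + i`. -/
noncomputable def reachable (m d : ℕ) : ℕ → Finset (SimpleGraph ℕ)
  | 0 => {initGraph m}
  | i + 1 => (reachable m d i).biUnion fun g =>
      ((lowDegSet d g (m + i)).powersetCard m).image (attachStep g (m + i + 1))

/-- The expected number of vertices whose degree becomes `k` in the step from time `n`. -/
noncomputable def stepDrift (m d : ℕ) (g : SimpleGraph ℕ) (n k : ℕ) : ℝ :=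
  m * ((lowDegSet d g n).filter (fun v => graphDeg g v + 1 = k)).card / (lowDegSet d g n).card

/-- The martingale part of the number of vertices of degree at least `k` at time `m + i`, as a
function of the graph at that time. -/
noncomputable def tailMartingale (m d k i : ℕ) (g : SimpleGraph ℕ) : ℝ :=
  tailCount g (m + i) k - (if k ≤ m then ((m + i : ℕ) : ℝ) else 0)
    - ∑ j ∈ Finset.range i, stepDrift m d (graphRestrict (m + j) g) (m + j) k

lemma mem_reachable_succ {m d i : ℕ} {h : SimpleGraph ℕ} :
    h ∈ reachable m d (i + 1) ↔ ∃ g ∈ reachable m d i, ∃ S ⊆ lowDegSet d g (m + i),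
      S.card = m ∧ attachStep g (m + i + 1) S = h := by
  simp [reachable, Finset.mem_powersetCard, and_assoc]

lemma IsAdmissible.of_mem_reachable {m d : ℕ} (hd : m ≤ d) {i : ℕ} :
    ∀ {g : SimpleGraph ℕ}, g ∈ reachable m d i → IsAdmissible m d (m + i) g := by
  induction i with
  | zero =>
    intro g hg
    rw [reachable, Finset.mem_singleton] at hg
    rw [hg]
    exact IsAdmissible.initGraph m d hd
  | succ i ih =>
    intro h hh
    obtain ⟨g, hg, S, hS, hSm, rfl⟩ := mem_reachable_succ.1 hh
    exact (ih hg).attachStep hd hS hSm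

lemma sum_reachable_succ {m d : ℕ} (hd : m ≤ d) (i : ℕ) (F : SimpleGraph ℕ → ℝ) :
    ∑ h ∈ reachable m d (i + 1), F h
      = ∑ g ∈ reachable m d i, ∑ S ∈ (lowDegSet d g (m + i)).powersetCard m,
          F (attachStep g (m + i + 1) S) := by
  classical
  have hsub : ∀ {g : SimpleGraph ℕ} {S : Finset ℕ}, S ∈ (lowDegSet d g (m + i)).powersetCard m →
      S ⊆ Finset.Icc 1 (m + i) := fun hS =>
    (Finset.mem_powersetCard.1 hS).1.trans (lowDegSet_subset _ _ _)
  rw [reachable, Finset.sum_biUnion]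
  · refine Finset.sum_congr rfl fun g hg => ?_
    rw [Finset.sum_image]
    intro S hS S' hS' h
    have hg' := IsAdmissible.of_mem_reachable hd hg
    exact (attachStep_inj hg' hg' (hsub hS) (hsub hS') h).2
  · intro g hg g' hg' hne
    rw [Function.onFun, Finset.disjoint_left]
    intro h h1 h2
    obtain ⟨S, hS, rfl⟩ := Finset.mem_image.1 h1
    obtain ⟨S', hS', h3⟩ := Finset.mem_image.1 h2
    exact hne (attachStep_inj (IsAdmissible.of_mem_reachable hd hg)
      (IsAdmissible.of_mem_reachable hd hg') (hsub hS) (hsub hS') h3.symm).1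

lemma tailMartingale_attachStep {m d i : ℕ} {g : SimpleGraph ℕ}
    (hg : IsAdmissible m d (m + i) g) {S : Finset ℕ} (hS : S ⊆ lowDegSet d g (m + i))
    (hSm : S.card = m) (k : ℕ) :
    tailMartingale m d k (i + 1) (attachStep g (m + i + 1) S)
      = tailMartingale m d k i g
        + ((S.filter (fun v => graphDeg g v + 1 = k)).card - stepDrift m d g (m + i) k) := by
  have h1 : ∀ j ∈ Finset.range (i + 1),
      stepDrift m d (graphRestrict (m + j) (attachStep g (m + i + 1) S)) (m + j) k
        = stepDrift m d (graphRestrict (m + j) g) (m + j) k := by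
    intro j hj
    rw [graphRestrict_attachStep]
    have := Finset.mem_range.1 hj
    omega
  rw [tailMartingale, tailMartingale, Finset.sum_congr rfl h1, Finset.sum_range_succ,
    hg.graphRestrict_eq, ← add_assoc m i 1,
    tailCount_attachStep hg (hS.trans (lowDegSet_subset _ _ _)), hSm]
  split_ifs <;> push_cast <;> ring

lemma tailMartingale_zero_right {m d : ℕ} (i : ℕ) (g : SimpleGraph ℕ) :
    tailMartingale m d 0 i g = 0 := by
  simp [tailMartingale, stepDrift, tailCount_zero]

lemma sum_exp_tailMartingale_attachStep_le {m d i : ℕ} (hm : 1 ≤ m) (hd : 2 * m < d)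
    {g : SimpleGraph ℕ} (hg : IsAdmissible m d (m + i) g) (k : ℕ) {t : ℝ} (ht : |t| * m ≤ 1) :
    ∑ S ∈ (lowDegSet d g (m + i)).powersetCard m,
        Real.exp (t * tailMartingale m d k (i + 1) (attachStep g (m + i + 1) S))
      ≤ ((lowDegSet d g (m + i)).card.choose m : ℝ)
        * (Real.exp (t ^ 2 * m ^ 2) * Real.exp (t * tailMartingale m d k i g)) := by
  set A := lowDegSet d g (m + i) with hA
  have hAm : m ≤ A.card := hg.le_card_lowDegSet hd (Nat.le_add_right _ _)
  set f : Finset ℕ → ℝ := fun S =>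
    (S.filter (fun v => graphDeg g v + 1 = k)).card - stepDrift m d g (m + i) k with hf
  have hsum : ∑ S ∈ A.powersetCard m, f S = 0 := by
    simp only [hf, stepDrift, ← hA]
    exact sum_powersetCard_card_filter A _ hm hAm
  have hbound : ∀ S ∈ A.powersetCard m, |f S| ≤ m := by
    intro S hS
    have hApos : (0 : ℝ) < A.card := by exact_mod_cast (by omega : 0 < A.card)
    have h1 : ((S.filter (fun v => graphDeg g v + 1 = k)).card : ℝ) ≤ m := by
      rw [← (Finset.mem_powersetCard.1 hS).2]
      exact_mod_cast Finset.card_filter_le _ _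
    have h2 : stepDrift m d g (m + i) k ≤ m := by
      rw [stepDrift, ← hA, div_le_iff₀ hApos]
      refine mul_le_mul_of_nonneg_left ?_ (Nat.cast_nonneg _)
      exact_mod_cast Finset.card_filter_le _ _
    have h3 : 0 ≤ stepDrift m d g (m + i) k := by
      rw [stepDrift]
      positivity
    have h4 : (0 : ℝ) ≤ (S.filter (fun v => graphDeg g v + 1 = k)).card := Nat.cast_nonneg _
    rw [abs_le]
    constructor <;> simp only [hf] <;> linarith
  have hmain := sum_exp_le_of_sum_eq_zero _ f hsum hbound ht
  rw [Finset.card_powersetCard] at hmain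
  calc _ = Real.exp (t * tailMartingale m d k i g)
          * ∑ S ∈ A.powersetCard m, Real.exp (t * f S) := by
        rw [Finset.mul_sum]
        refine Finset.sum_congr rfl fun S hS => ?_
        obtain ⟨hS1, hS2⟩ := Finset.mem_powersetCard.1 hS
        rw [tailMartingale_attachStep hg hS1 hS2, mul_add, Real.exp_add]
    _ ≤ Real.exp (t * tailMartingale m d k i g)
          * ((A.card.choose m : ℝ) * Real.exp (t ^ 2 * m ^ 2)) :=
        mul_le_mul_of_nonneg_left hmain (Real.exp_pos _).le
    _ = _ := by ring

lemma abs_tailMartingale_zero_le (m d k : ℕ) (g : SimpleGraph ℕ) :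
    |tailMartingale m d k 0 g| ≤ m := by
  have h : (tailCount g m k : ℝ) ≤ m := by
    have h1 : tailCount g m k ≤ (Finset.Icc 1 m).card := Finset.card_filter_le _ _
    rw [Nat.card_Icc, Nat.add_sub_cancel] at h1
    exact_mod_cast h1
  have h0 : (0 : ℝ) ≤ tailCount g m k := Nat.cast_nonneg _
  simp only [tailMartingale, add_zero, Finset.range_zero, Finset.sum_empty, sub_zero]
  rw [abs_le]
  split_ifs <;> constructor <;> linarith

/-! ### The law of the process -/

section Law

variable {m d : ℕ} {Ω : Type*} [MeasurableSpace Ω] {μ : Measure Ω}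
  {G : ℕ → Ω → SimpleGraph ℕ}

lemma IsUAProcess.real_step (hG : IsUAProcess m d μ G) {i : ℕ} {g : SimpleGraph ℕ} {S : Finset ℕ}
    (hS : S ⊆ lowDegSet d g (m + i)) (hSm : S.card = m) :
    μ.real ({ω | G (m + i + 1) ω = attachStep g (m + i + 1) S} ∩ {ω | G (m + i) ω = g})
      = μ.real {ω | G (m + i) ω = g} / ((lowDegSet d g (m + i)).card.choose m : ℝ) := by
  rw [measureReal_def, hG.2.2 (m + i) (Nat.le_add_right _ _) g S hS hSm, ENNReal.toReal_div]
  simp [measureReal_def]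

variable [IsProbabilityMeasure μ]

lemma sum_real_reachable_le_one (hG : IsUAProcess m d μ G) (i : ℕ) :
    ∑ g ∈ reachable m d i, μ.real {ω | G (m + i) ω = g} ≤ 1 := by
  rw [← measureReal_biUnion_finset]
  · exact measureReal_le_one
  · intro g _ g' _ hne
    exact Set.disjoint_left.2 fun ω h h' => hne (h.symm.trans h')
  · exact fun g _ => hG.1 _ _

lemma sum_real_step (hd : 2 * m < d) {i : ℕ} {g : SimpleGraph ℕ} (hg : g ∈ reachable m d i)
    (x : ℝ) :
    ∑ _S ∈ (lowDegSet d g (m + i)).powersetCard m,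
      x / ((lowDegSet d g (m + i)).card.choose m : ℝ) = x := by
  have hA := (IsAdmissible.of_mem_reachable (by omega) hg).le_card_lowDegSet hd
    (Nat.le_add_right _ _)
  have : ((lowDegSet d g (m + i)).card.choose m : ℝ) ≠ 0 := by
    exact_mod_cast (Nat.choose_pos hA).ne'
  rw [Finset.sum_const, Finset.card_powersetCard, nsmul_eq_mul]
  field_simp

lemma sum_real_reachable (hd : 2 * m < d) (hG : IsUAProcess m d μ G) (i : ℕ) :
    ∑ g ∈ reachable m d i, μ.real {ω | G (m + i) ω = g} = 1 := by
  induction i with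
  | zero => simp [reachable, hG.2.1]
  | succ i ih =>
    refine le_antisymm (sum_real_reachable_le_one hG _) ?_
    rw [sum_reachable_succ (by omega), ← ih]
    refine Finset.sum_le_sum fun g hg => ?_
    rw [← sum_real_step hd hg (μ.real {ω | G (m + i) ω = g})]
    refine Finset.sum_le_sum fun S hS => ?_
    obtain ⟨hS1, hS2⟩ := Finset.mem_powersetCard.1 hS
    rw [← hG.real_step hS1 hS2]
    exact measureReal_mono Set.inter_subset_left

lemma IsUAProcess.real_attachStep (hd : 2 * m < d) (hG : IsUAProcess m d μ G) {i : ℕ}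
    {g : SimpleGraph ℕ} (hg : g ∈ reachable m d i) {S : Finset ℕ}
    (hS : S ∈ (lowDegSet d g (m + i)).powersetCard m) :
    μ.real {ω | G (m + i + 1) ω = attachStep g (m + i + 1) S}
      = μ.real {ω | G (m + i) ω = g} / ((lowDegSet d g (m + i)).card.choose m : ℝ) := by
  have hle : ∀ g ∈ reachable m d i, ∀ S ∈ (lowDegSet d g (m + i)).powersetCard m,
      μ.real {ω | G (m + i) ω = g} / ((lowDegSet d g (m + i)).card.choose m : ℝ)
        ≤ μ.real {ω | G (m + i + 1) ω = attachStep g (m + i + 1) S} := by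
    intro g hg S hS
    obtain ⟨hS1, hS2⟩ := Finset.mem_powersetCard.1 hS
    rw [← hG.real_step hS1 hS2]
    exact measureReal_mono Set.inter_subset_left
  have htotal := sum_real_reachable hd hG (i + 1)
  rw [sum_reachable_succ (by omega), ← sum_real_reachable hd hG i,
    ← Finset.sum_congr rfl fun g hg => sum_real_step hd hg (μ.real {ω | G (m + i) ω = g})]
    at htotal
  have h1 := (Finset.sum_eq_sum_iff_of_le fun g hg => Finset.sum_le_sum (hle g hg)).1
    htotal.symm g hg
  exact ((Finset.sum_eq_sum_iff_of_le (hle g hg)).1 h1 S hS).symm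

lemma ae_mem_reachable (hd : 2 * m < d) (hG : IsUAProcess m d μ G) (i : ℕ) :
    ∀ᵐ ω ∂μ, G (m + i) ω ∈ reachable m d i := by
  have hset : {ω | G (m + i) ω ∈ reachable m d i}
      = ⋃ g ∈ reachable m d i, {ω | G (m + i) ω = g} := by
    ext ω
    simp
  have hmeas : MeasurableSet {ω | G (m + i) ω ∈ reachable m d i} := by
    rw [hset]
    exact Finset.measurableSet_biUnion _ fun g _ => hG.1 _ _
  have hreal : μ.real {ω | G (m + i) ω ∈ reachable m d i} = 1 := by
    rw [hset, measureReal_biUnion_finset, sum_real_reachable hd hG]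
    · intro g _ g' _ hne
      exact Set.disjoint_left.2 fun ω h h' => hne (h.symm.trans h')
    · exact fun g _ => hG.1 _ _
  refine (mem_ae_iff_prob_eq_one hmeas).2 ?_
  rw [← ofReal_measureReal, hreal, ENNReal.ofReal_one]

lemma ae_attachStep (hd : 2 * m < d) (hG : IsUAProcess m d μ G) (i : ℕ) :
    ∀ᵐ ω ∂μ, ∃ S ⊆ lowDegSet d (G (m + i) ω) (m + i), S.card = m ∧
      G (m + i + 1) ω = attachStep (G (m + i) ω) (m + i + 1) S := by
  have hnull : ∀ g ∈ reachable m d i, ∀ S ∈ (lowDegSet d g (m + i)).powersetCard m,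
      ∀ᵐ ω ∂μ, G (m + i + 1) ω = attachStep g (m + i + 1) S → G (m + i) ω = g := by
    intro g hg S hS
    obtain ⟨hS1, hS2⟩ := Finset.mem_powersetCard.1 hS
    have h1 : μ.real ({ω | G (m + i + 1) ω = attachStep g (m + i + 1) S} \
        {ω | G (m + i) ω = g}) = 0 := by
      have h2 := measureReal_inter_add_sdiff (μ := μ)
        (s := {ω | G (m + i + 1) ω = attachStep g (m + i + 1) S}) (hG.1 (m + i) g)
      rw [hG.real_step hS1 hS2, hG.real_attachStep hd hg hS] at h2
      linarith
    rw [measureReal_eq_zero_iff] at h1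
    rw [ae_iff]
    convert h1 using 2
    ext ω
    simp
  have hall : ∀ᵐ ω ∂μ, ∀ g ∈ reachable m d i, ∀ S ∈ (lowDegSet d g (m + i)).powersetCard m,
      G (m + i + 1) ω = attachStep g (m + i + 1) S → G (m + i) ω = g :=
    (Finset.eventually_all _).2 fun g hg => (Finset.eventually_all _).2 (hnull g hg)
  filter_upwards [hall, ae_mem_reachable hd hG (i + 1)] with ω h1 h2
  obtain ⟨g, hg, S, hS, hSm, h3⟩ := mem_reachable_succ.1 h2
  have h4 := h1 g hg S (Finset.mem_powersetCard.2 ⟨hS, hSm⟩) h3.symm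
  rw [h4]
  exact ⟨S, hS, hSm, h3.symm⟩

lemma sum_real_mul_exp_tailMartingale_le (hm : 1 ≤ m) (hd : 2 * m < d) (hG : IsUAProcess m d μ G)
    (k : ℕ) {t : ℝ} (ht : |t| * m ≤ 1) (i : ℕ) :
    ∑ g ∈ reachable m d i, μ.real {ω | G (m + i) ω = g} * Real.exp (t * tailMartingale m d k i g)
      ≤ Real.exp (t ^ 2 * m ^ 2 * i + 1) := by
  induction i with
  | zero =>
    have h1 : t * tailMartingale m d k 0 (initGraph m) ≤ 1 := by
      refine (le_abs_self _).trans (le_trans ?_ ht)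
      rw [abs_mul]
      exact mul_le_mul_of_nonneg_left (abs_tailMartingale_zero_le _ _ _ _) (abs_nonneg t)
    simpa [reachable, hG.2.1] using h1
  | succ i ih =>
    rw [sum_reachable_succ (by omega)]
    have hstep : ∀ g ∈ reachable m d i, ∑ S ∈ (lowDegSet d g (m + i)).powersetCard m,
        μ.real {ω | G (m + (i + 1)) ω = attachStep g (m + i + 1) S}
          * Real.exp (t * tailMartingale m d k (i + 1) (attachStep g (m + i + 1) S))
        ≤ Real.exp (t ^ 2 * m ^ 2) *
          (μ.real {ω | G (m + i) ω = g} * Real.exp (t * tailMartingale m d k i g)) := by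
      intro g hg
      have hadm := IsAdmissible.of_mem_reachable (by omega) hg
      have hC : (0 : ℝ) < ((lowDegSet d g (m + i)).card.choose m : ℝ) := by
        exact_mod_cast Nat.choose_pos (hadm.le_card_lowDegSet hd (Nat.le_add_right _ _))
      rw [Finset.sum_congr rfl fun S hS => by
        rw [← add_assoc, hG.real_attachStep hd hg hS], ← Finset.mul_sum]
      refine (mul_le_mul_of_nonneg_left
        (sum_exp_tailMartingale_attachStep_le hm hd hadm k ht) (by positivity)).trans_eq ?_
      field_simp
    refine (Finset.sum_le_sum hstep).trans ?_
    rw [← Finset.mul_sum]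
    refine (mul_le_mul_of_nonneg_left ih (Real.exp_pos _).le).trans_eq ?_
    rw [← Real.exp_add]
    push_cast
    ring_nf

lemma real_le_mul_tailMartingale_le (hm : 1 ≤ m) (hd : 2 * m < d) (hG : IsUAProcess m d μ G)
    (k : ℕ) {t : ℝ} (ht : |t| * m ≤ 1) (i : ℕ) (y : ℝ) :
    μ.real {ω | y ≤ t * tailMartingale m d k i (G (m + i) ω)}
      ≤ Real.exp (t ^ 2 * m ^ 2 * i + 1 - y) := by
  set R := (reachable m d i).filter fun g => y ≤ t * tailMartingale m d k i g with hR
  have hsub : {ω | y ≤ t * tailMartingale m d k i (G (m + i) ω)}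
      ≤ᵐ[μ] ⋃ g ∈ R, {ω | G (m + i) ω = g} := by
    filter_upwards [ae_mem_reachable hd hG i] with ω hω hy
    exact Set.mem_biUnion (x := G (m + i) ω) (Finset.mem_filter.2 ⟨hω, hy⟩) rfl
  calc μ.real {ω | y ≤ t * tailMartingale m d k i (G (m + i) ω)}
      ≤ μ.real (⋃ g ∈ R, {ω | G (m + i) ω = g}) :=
        ENNReal.toReal_mono (measure_ne_top _ _) (measure_mono_ae hsub)
    _ ≤ ∑ g ∈ R, μ.real {ω | G (m + i) ω = g} := measureReal_biUnion_finset_le _ _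
    _ ≤ ∑ g ∈ R, μ.real {ω | G (m + i) ω = g}
          * Real.exp (t * tailMartingale m d k i g - y) := by
        refine Finset.sum_le_sum fun g hg => le_mul_of_one_le_right measureReal_nonneg ?_
        exact Real.one_le_exp (sub_nonneg.2 (Finset.mem_filter.1 hg).2)
    _ ≤ ∑ g ∈ reachable m d i, μ.real {ω | G (m + i) ω = g}
          * Real.exp (t * tailMartingale m d k i g - y) :=
        Finset.sum_le_sum_of_subset_of_nonneg (Finset.filter_subset _ _)
          fun g _ _ => mul_nonneg measureReal_nonneg (Real.exp_pos _).le
    _ = (∑ g ∈ reachable m d i, μ.real {ω | G (m + i) ω = g}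
          * Real.exp (t * tailMartingale m d k i g)) * Real.exp (-y) := by
        rw [Finset.sum_mul]
        refine Finset.sum_congr rfl fun g _ => ?_
        rw [sub_eq_add_neg, Real.exp_add, mul_assoc]
    _ ≤ Real.exp (t ^ 2 * m ^ 2 * i + 1) * Real.exp (-y) :=
        mul_le_mul_of_nonneg_right (sum_real_mul_exp_tailMartingale_le hm hd hG k ht i)
          (Real.exp_pos _).le
    _ = _ := by rw [← Real.exp_add, sub_eq_add_neg]

lemma summable_exp_neg_mul_rpow {c δ : ℝ} (hc : 0 < c) (hδ : 0 < δ) :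
    Summable fun n : ℕ => Real.exp (-c * (n : ℝ) ^ δ) := by
  have h1 := (isLittleO_exp_neg_mul_rpow_atTop hc (-2 / δ)).comp_tendsto
    ((tendsto_rpow_atTop hδ).comp tendsto_natCast_atTop_atTop)
  refine summable_of_isBigO_nat (g := fun n : ℕ => (n : ℝ) ^ (-2 : ℝ))
    (Real.summable_nat_rpow.2 (by norm_num)) (h1.isBigO.congr (fun n => rfl) fun n => ?_)
  simp only [Function.comp_apply]
  rw [← Real.rpow_mul (Nat.cast_nonneg n)]
  congr 1
  field_simp

lemma ae_eventually_abs_tailMartingale_le (hm : 1 ≤ m) (hd : 2 * m < d) (hG : IsUAProcess m d μ G)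
    (k : ℕ) {δ : ℝ} (hδ : 0 < δ) :
    ∀ᵐ ω ∂μ, ∀ᶠ i : ℕ in atTop, |tailMartingale m d k i (G (m + i) ω)|
      ≤ ((m + i : ℕ) : ℝ) ^ (1 / 2 + δ) := by
  have hm' : (0 : ℝ) < m := by exact_mod_cast hm
  set b : ℕ → ℝ := fun i => 2 * Real.exp 2 * Real.exp (-(1 / (m : ℝ)) * ((i + m : ℕ) : ℝ) ^ δ)
    with hb
  have hbsum : Summable b := Summable.mul_left _
    ((summable_nat_add_iff m).2 (summable_exp_neg_mul_rpow (by positivity) hδ))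
  set s : ℕ → Set Ω := fun i => {ω | ((m + i : ℕ) : ℝ) ^ (1 / 2 + δ)
    < |tailMartingale m d k i (G (m + i) ω)|} with hs
  have hsb : ∀ i, μ.real (s i) ≤ b i := by
    intro i
    set x : ℝ := ((m + i : ℕ) : ℝ) with hx
    have hx1 : 1 ≤ x := by
      rw [hx]
      exact_mod_cast (by omega : 1 ≤ m + i)
    have hx0 : 0 < x := by linarith
    set t : ℝ := x ^ (-(1 / 2) : ℝ) / m with ht
    set y : ℝ := x ^ δ / m with hy
    have ht0 : 0 < t := by positivity
    have htm : t * m ≤ 1 := by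
      rw [ht, div_mul_cancel₀ _ hm'.ne']
      exact Real.rpow_le_one_of_one_le_of_nonpos hx1 (by norm_num)
    have htsq : t ^ 2 * m ^ 2 * i ≤ 1 := by
      have h1 : t ^ 2 * m ^ 2 = x⁻¹ := by
        rw [← mul_pow, ht, div_mul_cancel₀ _ hm'.ne', ← Real.rpow_natCast, ← Real.rpow_mul hx0.le]
        norm_num
        rw [Real.rpow_neg_one]
      rw [h1, inv_mul_le_one₀ hx0, hx]
      exact_mod_cast Nat.le_add_left i m
    have hty : t * x ^ (1 / 2 + δ) = y := by
      rw [ht, hy, div_mul_eq_mul_div, ← Real.rpow_add hx0]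
      congr 2
      ring
    have hcover : s i ⊆ {ω | y ≤ t * tailMartingale m d k i (G (m + i) ω)}
        ∪ {ω | y ≤ (-t) * tailMartingale m d k i (G (m + i) ω)} := by
      intro ω hω
      have h1 : x ^ (1 / 2 + δ) < |tailMartingale m d k i (G (m + i) ω)| := hω
      rcases lt_abs.1 h1 with h | h
      · left
        have := mul_le_mul_of_nonneg_left h.le ht0.le
        rwa [hty] at this
      · right
        have := mul_le_mul_of_nonneg_left h.le ht0.le
        rw [hty] at this
        simpa using this
    have habs : |t| * m ≤ 1 := by rwa [abs_of_pos ht0]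
    have hexp : ∀ u : ℝ, u ^ 2 = t ^ 2 → Real.exp (u ^ 2 * m ^ 2 * i + 1 - y)
        ≤ Real.exp 2 * Real.exp (-(1 / (m : ℝ)) * x ^ δ) := by
      intro u hu
      rw [← Real.exp_add, hu]
      refine Real.exp_le_exp.2 ?_
      have : -(1 / (m : ℝ)) * x ^ δ = -y := by rw [hy]; ring
      rw [this]
      linarith
    have h1 := (real_le_mul_tailMartingale_le hm hd hG k habs i y).trans (hexp t rfl)
    have h2 := (real_le_mul_tailMartingale_le hm hd hG k ((abs_neg t).symm ▸ habs) i y).trans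
      (hexp (-t) (neg_sq t))
    have h3 := (measureReal_mono (μ := μ) hcover).trans (measureReal_union_le _ _)
    simp only [hb]
    rw [add_comm i m, ← hx]
    linarith
  have hfin : ∑' i, μ (s i) ≠ ∞ := by
    refine ne_top_of_le_ne_top hbsum.tsum_ofReal_ne_top (ENNReal.tsum_le_tsum fun i => ?_)
    rw [← ofReal_measureReal]
    exact ENNReal.ofReal_le_ofReal (hsb i)
  filter_upwards [ae_eventually_notMem hfin] with ω hω
  filter_upwards [hω] with i hi
  exact not_lt.1 hi

end Law

/-! ### The deterministic recursion -/

lemma abs_le_of_perturbed_l1_contraction {d : ℕ} (D M q : ℕ → ℕ → ℝ) (a w : ℕ → ℝ) {K : ℝ}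
    {i₀ : ℕ} (hw : ∀ i, 0 < w i) (ha0 : ∀ i, i₀ ≤ i → 0 ≤ a i) (ha1 : ∀ i, i₀ ≤ i → a i ≤ 1)
    (haw : ∀ i, i₀ ≤ i → a i * w i ≤ K * (w (i + 1) - w i))
    (hwmono : ∀ i, i₀ ≤ i → w i ≤ w (i + 1))
    (hM : ∀ i, i₀ ≤ i → ∀ k, k ≤ d → |M i k| ≤ w i) (hD0 : ∀ i, D i 0 = 0) (hM0 : ∀ i, M i 0 = 0)
    (hq0 : ∀ i, i₀ ≤ i → ∀ k, k < d → 0 ≤ q i k)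
    (hq1 : ∀ i, i₀ ≤ i → ∑ k ∈ Finset.range d, q i k ≤ 1)
    (hrec : ∀ i, i₀ ≤ i → ∀ k, k < d → D (i + 1) (k + 1) - M (i + 1) (k + 1)
      = D i (k + 1) - M i (k + 1) + a i * (D i k - D i (k + 1) + q i k * D i d)) :
    ∃ C : ℝ, ∀ i, i₀ ≤ i → ∀ k, k ≤ d → |D i k| ≤ C * w i := by
  set B : ℕ → ℕ → ℝ := fun i k => D i k - M i k with hB
  set E : ℕ → ℝ := fun i => ∑ k ∈ Finset.range d, |B i (k + 1)| with hE
  have hB0 : ∀ i, B i 0 = 0 := fun i => by simp [hB, hD0, hM0]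
  have hstep : ∀ i, i₀ ≤ i → E (i + 1) ≤ E i + (2 * d + 1) * (a i * w i) := by
    intro i hi
    have ha := ha0 i hi
    have ha' := ha1 i hi
    have hpt : ∀ k ∈ Finset.range d, |B (i + 1) (k + 1)| ≤ (1 - a i) * |B i (k + 1)|
        + a i * |B i k| + a i * |B i d| * q i k + a i * w i * (2 + q i k) := by
      intro k hk
      rw [Finset.mem_range] at hk
      have hq := hq0 i hi k hk
      have e : B (i + 1) (k + 1) = (1 - a i) * B i (k + 1) + a i * B i k + a i * q i k * B i d
          + a i * (M i k - M i (k + 1) + q i k * M i d) := by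
        simp only [hB]
        rw [hrec i hi k hk]
        ring
      have h1 : |M i k - M i (k + 1) + q i k * M i d| ≤ w i * (2 + q i k) := by
        have b1 := abs_le.1 (hM i hi k hk.le)
        have b2 := abs_le.1 (hM i hi (k + 1) hk)
        have b3 := abs_le.1 (hM i hi d le_rfl)
        rw [abs_le]
        constructor <;> nlinarith [mul_le_mul_of_nonneg_left b3.1 hq,
          mul_le_mul_of_nonneg_left b3.2 hq]
      rw [e]
      refine (abs_add_le _ _).trans ?_
      refine (add_le_add_left ((abs_add_le _ _).trans
        (add_le_add_left (abs_add_le _ _) _)) _).trans ?_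
      rw [abs_mul, abs_mul, abs_mul, abs_mul, abs_mul, abs_of_nonneg ha, abs_of_nonneg hq,
        abs_of_nonneg (sub_nonneg.2 ha')]
      have := mul_le_mul_of_nonneg_left h1 ha
      linarith
    have hsum := Finset.sum_le_sum hpt
    simp only [Finset.sum_add_distrib, ← Finset.mul_sum] at hsum
    have hshift : ∑ k ∈ Finset.range d, |B i k| + |B i d| = E i := by
      rw [← Finset.sum_range_succ, Finset.sum_range_succ', hB0, abs_zero, add_zero]
    have hq := hq1 i hi
    have h2 : a i * |B i d| * ∑ k ∈ Finset.range d, q i k ≤ a i * |B i d| :=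
      mul_le_of_le_one_right (by positivity) hq
    have h3 : a i * w i * ∑ k ∈ Finset.range d, q i k ≤ a i * w i :=
      mul_le_of_le_one_right (mul_nonneg ha (hw i).le) hq
    simp only [Finset.sum_const, Finset.card_range, nsmul_eq_mul] at hsum
    have : (1 - a i) * E i + a i * ∑ k ∈ Finset.range d, |B i k| + a i * |B i d| = E i := by
      rw [← hshift]
      ring
    simp only [hE] at this ⊢
    nlinarith
  set C₀ : ℝ := max (E i₀ / w i₀) ((2 * d + 1) * K) with hC₀
  have hEbound : ∀ i, i₀ ≤ i → E i ≤ C₀ * w i := by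
    intro i hi
    induction i, hi using Nat.le_induction with
    | base => exact (div_le_iff₀ (hw i₀)).1 (le_max_left _ _)
    | succ i hi ih =>
      have h1 := hstep i hi
      have h2 : (2 * (d : ℝ) + 1) * (a i * w i) ≤ C₀ * (w (i + 1) - w i) := by
        calc (2 * (d : ℝ) + 1) * (a i * w i) ≤ (2 * d + 1) * (K * (w (i + 1) - w i)) :=
              mul_le_mul_of_nonneg_left (haw i hi) (by positivity)
          _ = ((2 * d + 1) * K) * (w (i + 1) - w i) := by ring
          _ ≤ _ := mul_le_mul_of_nonneg_right (le_max_right _ _)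
              (sub_nonneg.2 (hwmono i hi))
      linarith
  refine ⟨C₀ + 1, fun i hi k hk => ?_⟩
  have hBk : |B i k| ≤ C₀ * w i := by
    refine le_trans ?_ (hEbound i hi)
    rcases k with _ | k
    · rw [hB0, abs_zero]
      exact Finset.sum_nonneg fun _ _ => abs_nonneg _
    · exact Finset.single_le_sum (f := fun k => |B i (k + 1)|) (fun _ _ => abs_nonneg _)
        (Finset.mem_range.2 hk)
  have : D i k = B i k + M i k := by simp [hB]
  rw [this]
  have h1 := abs_add_le (B i k) (M i k)
  have h2 := hM i hi k hk
  linarith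

lemma rpow_add_div_le {x α : ℝ} (hx : 1 ≤ x) (hα : 1 / 2 ≤ α) :
    x ^ α + x ^ α / (3 * x) ≤ (x + 1) ^ α := by
  have hx0 : 0 < x := by linarith
  have h1 : 1 + 1 / (3 * x) ≤ (1 + 1 / x) ^ α := by
    have hy : 0 < 1 / x := by positivity
    have hy1 : 1 / x ≤ 1 := by rw [div_le_one hx0]; exact hx
    have e : 1 / (3 * x) = 1 / x / 3 := by field_simp
    calc 1 + 1 / (3 * x) ≤ Real.sqrt (1 + 1 / x) := by
          apply Real.le_sqrt_of_sq_le
          rw [e]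
          nlinarith
      _ = (1 + 1 / x) ^ (1 / 2 : ℝ) := Real.sqrt_eq_rpow _
      _ ≤ (1 + 1 / x) ^ α := Real.rpow_le_rpow_of_exponent_le (by linarith) hα
  have h2 : x + 1 = x * (1 + 1 / x) := by field_simp
  rw [h2, Real.mul_rpow hx0.le (by positivity)]
  calc x ^ α + x ^ α / (3 * x) = x ^ α * (1 + 1 / (3 * x)) := by ring
    _ ≤ _ := mul_le_mul_of_nonneg_left h1 (by positivity)

lemma pow_tail_step {m : ℕ} {z c : ℝ} (hz : z = c * (1 - z)) (k : ℕ) :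
    z ^ (k + 1 - m) - (if k + 1 ≤ m then (1 : ℝ) else 0)
      = c * (z ^ (k - m) - z ^ (k + 1 - m)) := by
  split_ifs with h
  · rw [Nat.sub_eq_zero_of_le h, Nat.sub_eq_zero_of_le (by omega : k ≤ m)]
    ring
  · rw [show k + 1 - m = k - m + 1 by omega, pow_succ]
    linear_combination z ^ (k - m) * hz

lemma tailCount_sub_le_of_tailMartingale_le {m d : ℕ} (hm : 1 ≤ m) (hd : 2 * m < d)
    {x z : ℝ} (hx1 : x < 1) (hz : z = m / (m + 1 - x)) (hzx : z ^ (d - m) = x)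
    {g : ℕ → SimpleGraph ℕ} (hg : ∀ i, g i ∈ reachable m d i)
    (hstep : ∀ i, ∃ S ⊆ lowDegSet d (g i) (m + i), S.card = m ∧
      g (i + 1) = attachStep (g i) (m + i + 1) S)
    {α : ℝ} (hα : 1 / 2 ≤ α)
    (hM : ∀ᶠ i in atTop, ∀ k ≤ d, |tailMartingale m d k i (g i)| ≤ ((m + i : ℕ) : ℝ) ^ α) :
    ∃ C : ℝ, ∀ᶠ i in atTop, ∀ k ≤ d,
      |(tailCount (g i) (m + i) k : ℝ) - (m + i : ℕ) * z ^ (k - m)|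
        ≤ C * ((m + i : ℕ) : ℝ) ^ α := by
  have hx' : 0 < 1 - x := by linarith
  have hm0 : (0 : ℝ) < m := by exact_mod_cast hm
  set c : ℝ := m / (1 - x) with hc
  have hc0 : 0 < c := by positivity
  have hcx : c * (1 - x) = m := by rw [hc]; field_simp
  have hzc : z = c * (1 - z) := by
    have : (m : ℝ) + 1 - x ≠ 0 := by linarith
    rw [hz, hc]
    field_simp
    ring
  have hadm : ∀ i, IsAdmissible m d (m + i) (g i) := fun i =>
    IsAdmissible.of_mem_reachable (by omega) (hg i)
  have hpos : ∀ i, (0 : ℝ) < ((m + i : ℕ) : ℝ) := fun i => by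
    exact_mod_cast (by omega : 0 < m + i)
  have hLpos : ∀ i, (0 : ℝ) < (lowDegSet d (g i) (m + i)).card := fun i => by
    have := (hadm i).le_card_lowDegSet hd (Nat.le_add_right m i)
    exact_mod_cast (by omega : 0 < (lowDegSet d (g i) (m + i)).card)
  obtain ⟨i₁, hi₁⟩ := eventually_atTop.1 hM
  have hlarge : ∀ᶠ i : ℕ in atTop, c ≤ ((m + i : ℕ) : ℝ) := by
    filter_upwards [eventually_ge_atTop ⌈c⌉₊] with i hi
    refine (Nat.le_ceil c).trans ?_
    exact_mod_cast hi.trans (Nat.le_add_left _ _)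
  obtain ⟨i₂, hi₂⟩ := eventually_atTop.1 hlarge
  have hgrowth : ∀ i : ℕ, ((m + i : ℕ) : ℝ) ^ α + ((m + i : ℕ) : ℝ) ^ α / (3 * (m + i : ℕ))
      ≤ ((m + (i + 1) : ℕ) : ℝ) ^ α := fun i => by
    have := rpow_add_div_le (x := ((m + i : ℕ) : ℝ)) (by exact_mod_cast (by omega)) hα
    rwa [← Nat.cast_add_one, add_assoc] at this
  obtain ⟨C, hC⟩ := abs_le_of_perturbed_l1_contraction (d := d)
    (fun i k => (tailCount (g i) (m + i) k : ℝ) - (m + i : ℕ) * z ^ (k - m))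
    (fun i k => tailMartingale m d k i (g i))
    (fun i k => ((tailCount (g i) (m + i) k : ℝ) - tailCount (g i) (m + i) (k + 1))
      / (lowDegSet d (g i) (m + i)).card)
    (fun i => c / (m + i : ℕ)) (fun i => ((m + i : ℕ) : ℝ) ^ α) (K := 3 * c) (i₀ := max i₁ i₂)
    (fun i => Real.rpow_pos_of_pos (hpos i) α)
    (fun i _ => div_nonneg hc0.le (hpos i).le)
    (fun i hi => (div_le_one (hpos i)).2 (hi₂ i (le_of_max_le_right hi)))
    (fun i _ => by
      have h1 := mul_le_mul_of_nonneg_left (hgrowth i) (by positivity : 0 ≤ 3 * c)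
      have h2 := hpos i
      have h3 : c / ((m + i : ℕ) : ℝ) * ((m + i : ℕ) : ℝ) ^ α
          = 3 * c * (((m + i : ℕ) : ℝ) ^ α / (3 * (m + i : ℕ))) := by
        field_simp
      rw [h3]
      linarith)
    (fun i _ => by
      have h1 := hgrowth i
      have h2 : 0 ≤ ((m + i : ℕ) : ℝ) ^ α / (3 * (m + i : ℕ)) := by positivity
      linarith)
    (fun i hi k hk => hi₁ i (le_of_max_le_left hi) k hk)
    (fun i => by simp [tailCount_zero])
    (fun i => tailMartingale_zero_right i (g i))
    (fun i _ k hk => by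
      refine div_nonneg (sub_nonneg.2 ?_) (hLpos i).le
      exact_mod_cast (card_lowDegSet_filter hk (g i) (m + i)).ge.trans' (Nat.le_add_right _ _))
    (fun i _ => by
      rw [← Finset.sum_div, Finset.sum_range_sub', div_le_one (hLpos i), tailCount_zero]
      have := card_lowDegSet_add_tailCount d (g i) (m + i)
      rw [sub_le_iff_le_add]
      exact_mod_cast this.ge)
    (fun i _ k hk => by
      obtain ⟨S, hS, hSm, hgS⟩ := hstep i
      have hmart := tailMartingale_attachStep (hadm i) hS hSm (k + 1)
      have htail := tailCount_attachStep (hadm i) (hS.trans (lowDegSet_subset _ _ _)) (k + 1)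
      rw [← hgS] at hmart htail
      have hN : (((lowDegSet d (g i) (m + i)).filter
          (fun v => graphDeg (g i) v + 1 = k + 1)).card : ℝ)
          = tailCount (g i) (m + i) k - tailCount (g i) (m + i) (k + 1) := by
        rw [eq_sub_iff_add_eq']
        exact_mod_cast (card_lowDegSet_filter hk (g i) (m + i)).symm
      have hL : ((lowDegSet d (g i) (m + i)).card : ℝ) + tailCount (g i) (m + i) d
          = ((m + i : ℕ) : ℝ) := by
        exact_mod_cast card_lowDegSet_add_tailCount d (g i) (m + i)
      have htail' : (tailCount (g (i + 1)) (m + (i + 1)) (k + 1) : ℝ)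
          = tailCount (g i) (m + i) (k + 1) + (if k + 1 ≤ m then (1 : ℝ) else 0)
            + (S.filter (fun v => graphDeg (g i) v + 1 = k + 1)).card := by
        rw [← add_assoc m i 1, htail, hSm]
        push_cast
        ring
      have hsucc : ((m + (i + 1) : ℕ) : ℝ) = ((m + i : ℕ) : ℝ) + 1 := by
        push_cast
        ring
      have hpow := pow_tail_step (m := m) hzc k
      rw [hmart, htail', stepDrift, hN, hsucc, hzx]
      have h1 := hpos i
      have h2 := hLpos i
      rw [← eq_sub_iff_add_eq'] at hL
      rw [hL]
      set n : ℝ := ((m + i : ℕ) : ℝ)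
      set L : ℝ := ((lowDegSet d (g i) (m + i)).card : ℝ)
      set u : ℝ := (tailCount (g i) (m + i) k : ℝ)
      set v : ℝ := (tailCount (g i) (m + i) (k + 1) : ℝ)
      have hdrift : c / n * (u - n * z ^ (k - m) - (v - n * z ^ (k + 1 - m))
          + (u - v) / L * (n - L - n * x))
          = m * (u - v) / L - c * (z ^ (k - m) - z ^ (k + 1 - m)) := by
        rw [← hcx]
        field_simp
        ring
      rw [hdrift, ← hpow]
      ring)
  exact ⟨C, eventually_atTop.2 ⟨max i₁ i₂, hC⟩⟩

lemma ae_tendsto_degCount_rate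
    {m d : ℕ} (hm : 1 ≤ m) (hd : 2 * m < d)
    {Ω : Type*} [MeasurableSpace Ω] {μ : Measure Ω} [IsProbabilityMeasure μ]
    {G : ℕ → Ω → SimpleGraph ℕ} (hG : IsUAProcess m d μ G) {ρ : ℕ → ℝ} (hρ1 : ρ d < 1)
    (hρd_root : ((m : ℝ) / ((m : ℝ) + 1 - ρ d)) ^ (d - m) = ρ d)
    (hρ : ∀ k : ℕ, m ≤ k → k ≤ d - 1 →
      ρ k = (1 - ρ d) * (m : ℝ) ^ (k - m) / ((m : ℝ) + 1 - ρ d) ^ (k - m + 1))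
    {k : ℕ} (hk1 : m ≤ k) (hk2 : k ≤ d) {δ : ℝ} (hδ : 0 < δ) :
    ∀ᵐ ω ∂μ, Tendsto (fun n : ℕ =>
          |(degCount (G n ω) n k : ℝ) / n - ρ k| / (n : ℝ) ^ (-(1 / 2 : ℝ) + δ))
        atTop (𝓝 (0 : ℝ)) := by
  have hδ2 : 0 < δ / 2 := by positivity
  have hmart : ∀ᵐ ω ∂μ, ∀ j, ∀ᶠ i : ℕ in atTop, |tailMartingale m d j i (G (m + i) ω)|
      ≤ ((m + i : ℕ) : ℝ) ^ (1 / 2 + δ / 2) :=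
    ae_all_iff.2 fun j => ae_eventually_abs_tailMartingale_le hm hd hG j hδ2
  filter_upwards [hmart, ae_all_iff.2 (ae_mem_reachable hd hG), ae_all_iff.2 (ae_attachStep hd hG)]
    with ω hω hreach hstep
  set z : ℝ := m / (m + 1 - ρ d) with hz
  obtain ⟨C, hC⟩ := tailCount_sub_le_of_tailMartingale_le hm hd hρ1 hz hρd_root
    (g := fun i => G (m + i) ω) hreach hstep (α := 1 / 2 + δ / 2) (by linarith) (by
      have := (Finset.eventually_all (Finset.range (d + 1))).2 fun j _ => hω j
      filter_upwards [this] with i hi j hj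
      exact hi j (Finset.mem_range.2 (by omega)))
  have hC0 : ∀ᶠ i : ℕ in atTop, 0 ≤ C * ((m + i : ℕ) : ℝ) ^ (1 / 2 + δ / 2) := by
    filter_upwards [hC] with i hi
    exact (abs_nonneg _).trans (hi 0 (Nat.zero_le d))
  have hdeg : ∀ᶠ i : ℕ in atTop,
      |(degCount (G (m + i) ω) (m + i) k : ℝ) - (m + i : ℕ) * ρ k|
        ≤ 2 * C * ((m + i : ℕ) : ℝ) ^ (1 / 2 + δ / 2) := by
    filter_upwards [hC, hC0] with i hi hi0
    rcases hk2.lt_or_eq with hlt | rfl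
    · have hρk : ρ k = z ^ (k - m) - z ^ (k + 1 - m) := by
        have : (m : ℝ) + 1 - ρ d ≠ 0 := by
          have : (0 : ℝ) ≤ m := Nat.cast_nonneg m
          linarith
        rw [hρ k hk1 (by omega), show k + 1 - m = k - m + 1 by omega, hz, pow_succ, pow_succ,
          div_pow]
        field_simp
        ring
      have hcount : (degCount (G (m + i) ω) (m + i) k : ℝ)
          = tailCount (G (m + i) ω) (m + i) k - tailCount (G (m + i) ω) (m + i) (k + 1) := by
        rw [eq_sub_iff_add_eq]
        exact_mod_cast degCount_add_tailCount (G (m + i) ω) (m + i) k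
      have h1 := abs_le.1 (hi k hk2)
      have h2 := abs_le.1 (hi (k + 1) hlt)
      rw [hρk, hcount, abs_le]
      constructor <;> linarith [h1.1, h1.2, h2.1, h2.2]
    · have h1 := hi k le_rfl
      rw [hρd_root] at h1
      rw [(IsAdmissible.of_mem_reachable hk1 (hreach i)).degCount_eq_tailCount]
      linarith
  have hdecay : Tendsto (fun n : ℕ => 2 * C * (n : ℝ) ^ (-(δ / 2))) atTop (𝓝 0) := by
    simpa using ((tendsto_rpow_neg_atTop hδ2).comp tendsto_natCast_atTop_atTop).const_mul (2 * C)
  refine squeeze_zero' (Eventually.of_forall fun n => by positivity) ?_ hdecay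
  obtain ⟨i₀, hi₀⟩ := eventually_atTop.1 hdeg
  filter_upwards [eventually_ge_atTop (m + i₀)] with n hn
  obtain ⟨i, rfl⟩ : ∃ i, n = m + i := ⟨n - m, by omega⟩
  have hi := hi₀ i (by omega)
  have hn0 : (0 : ℝ) < ((m + i : ℕ) : ℝ) := by exact_mod_cast (by omega : 0 < m + i)
  set x : ℝ := ((m + i : ℕ) : ℝ)
  have e : (degCount (G (m + i) ω) (m + i) k : ℝ) / x - ρ k
      = (degCount (G (m + i) ω) (m + i) k - x * ρ k) / x := by
    field_simp
  rw [e, abs_div, abs_of_pos hn0, div_div, div_le_iff₀ (by positivity)]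
  refine hi.trans_eq ?_
  have : x ^ (1 / 2 + δ / 2) = x ^ (-(δ / 2)) * (x * x ^ (-(1 / 2 : ℝ) + δ)) := by
    nth_rewrite 3 [← Real.rpow_one x]
    rw [← Real.rpow_add hn0, ← Real.rpow_add hn0]
    congr 1
    ring
  rw [this]
  ring

/-- In the bounded-degree uniform attachment process, for every `m ≤ k ≤ d` the fraction
`X_k(n) = N_k(n)/n` of vertices of degree `k` converges almost surely to `ρ_k`, with rate
`|X_k(n) − ρ_k| = o(n^{−1/2+δ})` almost surely for every `δ > 0`. -/
theorem uniform_attachment_degree_fractions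
    (m d : ℕ) (hm : 1 ≤ m) (hd : 2 * m < d)
    {Ω : Type*} [MeasurableSpace Ω] (μ : Measure Ω) [IsProbabilityMeasure μ]
    (G : ℕ → Ω → SimpleGraph ℕ) (hG : IsUAProcess m d μ G)
    (ρ : ℕ → ℝ)
    (hρd_mem : ρ d ∈ Set.Ioo (0 : ℝ) (2 * m / d))
    (hρd_root : ((m : ℝ) / ((m : ℝ) + 1 - ρ d)) ^ (d - m) = ρ d)
    (hρ : ∀ k : ℕ, m ≤ k → k ≤ d - 1 →
      ρ k = (1 - ρ d) * (m : ℝ) ^ (k - m) / ((m : ℝ) + 1 - ρ d) ^ (k - m + 1))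
    (k : ℕ) (hk1 : m ≤ k) (hk2 : k ≤ d) :
    (∀ᵐ ω ∂μ, Tendsto (fun n : ℕ => (degCount (G n ω) n k : ℝ) / n) atTop (𝓝 (ρ k))) ∧
    (∀ δ : ℝ, 0 < δ → ∀ᵐ ω ∂μ,
      Tendsto (fun n : ℕ =>
          |(degCount (G n ω) n k : ℝ) / n - ρ k| / (n : ℝ) ^ (-(1 / 2 : ℝ) + δ))
        atTop (𝓝 (0 : ℝ))) := by
  have hρ1 : ρ d < 1 := by
    refine hρd_mem.2.trans ?_
    have hd0 : (0 : ℝ) < d := by exact_mod_cast (by omega : 0 < d)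
    rw [div_lt_one hd0]
    exact_mod_cast hd
  have hrate := fun (δ : ℝ) (hδ : 0 < δ) =>
    ae_tendsto_degCount_rate hm hd hG hρ1 hρd_root hρ hk1 hk2 hδ
  refine ⟨?_, hrate⟩
  filter_upwards [hrate (1 / 4) (by norm_num)] with ω hω
  rw [tendsto_iff_norm_sub_tendsto_zero]
  have hpow : Tendsto (fun n : ℕ => (n : ℝ) ^ (-(1 / 4 : ℝ))) atTop (𝓝 0) :=
    (tendsto_rpow_neg_atTop (by norm_num)).comp tendsto_natCast_atTop_atTop
  have hmul := hω.mul hpow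
  rw [mul_zero] at hmul
  refine hmul.congr' ?_
  filter_upwards [eventually_gt_atTop 0] with n hn
  have hn0 : (0 : ℝ) < n := by exact_mod_cast hn
  rw [Real.norm_eq_abs, show -(1 / 2 : ℝ) + 1 / 4 = -(1 / 4) by norm_num]
  exact div_mul_cancel₀ _ (by positivity)
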